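/- arXiv:1908.09331 — 4 statements merged into one kernel-verified Lean document; each statement's English description precedes it below -/
import Mathlib

section
/- Let C > 0 and let K₁, K₂ : ℤ² → (0,∞) be kernels satisfying K₁(m) ≤ C·(1+|m|²)^{-1} and K₂(m) ≤ C·(1+|m|²)^{-1} for all m ∈ ℤ². Then for every ε ∈ (0,1) there exists a constant C_ε > 0, depending only on C and ε, such that for every m ∈ ℤ², Σ_{l∈ℤ²} K₁(m−l)·K₂(l) ≤ C_ε·(1+|m|²)^{ε−1}, and for every N ≥ 1 also Σ_{l∈ℤ², |l|≤N} K₁(m−l)·K₂(l) ≤ C_ε·(1+|m|²)^{ε−1}. -/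
open scoped BigOperators

/-- Squared Euclidean norm of a lattice point of `ℤ²`. -/
noncomputable def nsq (m : ℤ × ℤ) : ℝ := (m.1 : ℝ) ^ 2 + (m.2 : ℝ) ^ 2

/-- Euclidean norm of a lattice point of `ℤ²`. -/
noncomputable def norm2 (m : ℤ × ℤ) : ℝ := Real.sqrt (nsq m)

lemma aux_one (p : ℝ) (hp : 1 < p) :
    Summable (fun x : ℤ => (1 + (x : ℝ) ^ 2) ^ (-(p / 2))) := by
  have h1 : Summable (fun x : ℤ => |(x : ℝ)| ^ (-p)) := Real.summable_abs_int_rpow hp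
  have h2 : Summable (fun x : ℤ => if x = 0 then (1 : ℝ) else 0) :=
    summable_of_ne_finset_zero (s := {0}) (by intro b hb; simp at hb; simp [hb])
  refine Summable.of_nonneg_of_le (fun x => by positivity) (fun x => ?_) (h1.add h2)
  by_cases hx : x = 0
  · subst hx
    have : (0 : ℝ) ≤ |((0 : ℤ) : ℝ)| ^ (-p) := by positivity
    simp at this ⊢
    exact this
  · have hx' : (x : ℝ) ≠ 0 := by exact_mod_cast hx
    have hpos : 0 < |(x : ℝ)| := abs_pos.mpr hx'
    have e : |(x : ℝ)| ^ (-p) = (|(x : ℝ)| ^ 2) ^ (-(p / 2)) := by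
      rw [← Real.rpow_natCast, ← Real.rpow_mul hpos.le]
      congr 1
      push_cast
      ring
    simp only [hx, if_false, add_zero]
    rw [e, sq_abs]
    exact Real.rpow_le_rpow_of_nonpos (by positivity) (by linarith) (by linarith)

lemma aux_two (ε : ℝ) (hε0 : 0 < ε) :
    Summable (fun l : ℤ × ℤ => (1 + nsq l) ^ (-(1 + ε))) := by
  have h := aux_one (1 + ε) (by linarith)
  have h2 := h.mul_of_nonneg h (fun x => by positivity) (fun x => by positivity)
  refine Summable.of_nonneg_of_le (fun x => ?_) (fun x => ?_) h2
  · unfold nsq; positivity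
  · have e : (1 + nsq x) ^ (-(1 + ε)) = ((1 + nsq x) ^ 2) ^ (-((1 + ε) / 2)) := by
      have : (0 : ℝ) ≤ 1 + nsq x := by unfold nsq; positivity
      rw [← Real.rpow_natCast, ← Real.rpow_mul this]
      congr 1
      push_cast
      ring
    rw [e, ← Real.mul_rpow (by positivity) (by positivity)]
    refine Real.rpow_le_rpow_of_nonpos (by positivity) ?_ (by linarith)
    unfold nsq
    nlinarith [sq_nonneg ((x.1 : ℝ)), sq_nonneg ((x.2 : ℝ)),
      mul_nonneg (sq_nonneg ((x.1 : ℝ))) (sq_nonneg ((x.2 : ℝ))),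
      sq_nonneg ((x.1 : ℝ) ^ 2), sq_nonneg ((x.2 : ℝ) ^ 2)]

lemma aux_half (ε : ℝ) (hε0 : 0 < ε) (hε1 : ε < 1) (a b M : ℝ) (hb : 0 < b)
    (hM : 0 < M) (hba : b ≤ a) (hMa : M ≤ 4 * a) :
    a ^ (-1 : ℝ) * b ^ (-1 : ℝ) ≤ 4 * M ^ (ε - 1) * b ^ (-(1 + ε)) := by
  have ha : 0 < a := hb.trans_le hba
  have e1 : a ^ (-1 : ℝ) = a ^ (ε - 1) * a ^ (-ε) := by
    rw [← Real.rpow_add ha]; congr 1; ring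
  have e2 : b ^ (-(1 + ε)) = b ^ (-ε) * b ^ (-1 : ℝ) := by
    rw [← Real.rpow_add hb]; congr 1; ring
  have i1 : a ^ (-ε) ≤ b ^ (-ε) := Real.rpow_le_rpow_of_nonpos hb hba (by linarith)
  have i2 : a ^ (ε - 1) ≤ 4 * M ^ (ε - 1) := by
    have h1 : a ^ (ε - 1) ≤ (M / 4) ^ (ε - 1) :=
      Real.rpow_le_rpow_of_nonpos (by positivity) (by linarith) (by linarith)
    have h2 : (M / 4) ^ (ε - 1) = M ^ (ε - 1) * 4 ^ (1 - ε) := by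
      rw [Real.div_rpow hM.le (by norm_num), div_eq_mul_inv, ← Real.rpow_neg (by norm_num)]
      congr 2; ring
    have h3 : (4 : ℝ) ^ (1 - ε) ≤ 4 ^ (1 : ℝ) :=
      Real.rpow_le_rpow_of_exponent_le (by norm_num) (by linarith)
    rw [Real.rpow_one] at h3
    have h4 : 0 ≤ M ^ (ε - 1) := by positivity
    nlinarith
  rw [e1, e2, ← mul_assoc]
  gcongr

lemma aux_pt (ε : ℝ) (hε0 : 0 < ε) (hε1 : ε < 1) (m l : ℤ × ℤ) :
    (1 + nsq (m - l)) ^ (-1 : ℝ) * (1 + nsq l) ^ (-1 : ℝ) ≤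
      4 * (1 + nsq m) ^ (ε - 1) * ((1 + nsq (m - l)) ^ (-(1 + ε)) + (1 + nsq l) ^ (-(1 + ε))) := by
  have hn : ∀ k, 0 < 1 + nsq k := fun k => by unfold nsq; positivity
  have hM : 1 + nsq m ≤ 2 * ((1 + nsq (m - l)) + (1 + nsq l)) := by
    unfold nsq
    simp only [Prod.fst_sub, Prod.snd_sub, Int.cast_sub]
    nlinarith [sq_nonneg ((m.1 : ℝ) - 2 * l.1), sq_nonneg ((m.2 : ℝ) - 2 * l.2)]
  have ha := hn (m - l)
  have hb := hn l
  have hm := hn m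
  rw [mul_add]
  have p1 : 0 ≤ 4 * (1 + nsq m) ^ (ε - 1) * (1 + nsq (m - l)) ^ (-(1 + ε)) := by positivity
  have p2 : 0 ≤ 4 * (1 + nsq m) ^ (ε - 1) * (1 + nsq l) ^ (-(1 + ε)) := by positivity
  rcases le_total (1 + nsq l) (1 + nsq (m - l)) with h | h
  · have := aux_half ε hε0 hε1 _ _ _ hb hm h (by linarith)
    linarith
  · have := aux_half ε hε0 hε1 _ _ _ ha hm h (by linarith)
    rw [mul_comm] at this
    linarith

theorem stmt_1 (C : ℝ) (hC : 0 < C) (ε : ℝ) (hε0 : 0 < ε) (hε1 : ε < 1) :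
    ∃ Cε : ℝ, 0 < Cε ∧
      ∀ K₁ K₂ : ℤ × ℤ → ℝ,
        (∀ m, 0 < K₁ m) → (∀ m, 0 < K₂ m) →
        (∀ m, K₁ m ≤ C * (1 + nsq m) ^ (-1 : ℝ)) →
        (∀ m, K₂ m ≤ C * (1 + nsq m) ^ (-1 : ℝ)) →
        (∀ m : ℤ × ℤ,
          (∑' l : ℤ × ℤ, K₁ (m - l) * K₂ l) ≤ Cε * (1 + nsq m) ^ (ε - 1)) ∧
        (∀ N : ℕ, 1 ≤ N → ∀ m : ℤ × ℤ,
          (∑' l : ℤ × ℤ,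
              Set.indicator {l : ℤ × ℤ | norm2 l ≤ (N : ℝ)} (fun l => K₁ (m - l) * K₂ l) l)
            ≤ Cε * (1 + nsq m) ^ (ε - 1)) := by
  have hS := aux_two ε hε0
  have hn : ∀ k, 0 < 1 + nsq k := fun k => by unfold nsq; positivity
  set S : ℝ := ∑' l : ℤ × ℤ, (1 + nsq l) ^ (-(1 + ε)) with hSdef
  have hS0 : 0 ≤ S := tsum_nonneg fun l => (Real.rpow_pos_of_pos (hn l) _).le
  refine ⟨C ^ 2 * 4 * (S + S) + 1, by positivity, ?_⟩
  intro K₁ K₂ h1 h2 b1 b2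
  have key : ∀ (m : ℤ × ℤ) (f : ℤ × ℤ → ℝ), (∀ l, 0 ≤ f l) →
      (∀ l, f l ≤ K₁ (m - l) * K₂ l) →
      ∑' l, f l ≤ (C ^ 2 * 4 * (S + S) + 1) * (1 + nsq m) ^ (ε - 1) := by
    intro m f hf0 hf
    have hS' : Summable (fun l : ℤ × ℤ => (1 + nsq (m - l)) ^ (-(1 + ε))) :=
      (Equiv.subLeft m).summable_iff.mpr hS
    have hSe : ∑' l : ℤ × ℤ, (1 + nsq (m - l)) ^ (-(1 + ε)) = S :=
      (Equiv.subLeft m).tsum_eq (fun l : ℤ × ℤ => (1 + nsq l) ^ (-(1 + ε)))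
    have hg := (hS'.add hS).mul_left (C ^ 2 * (4 * (1 + nsq m) ^ (ε - 1)))
    have hle : ∀ l, f l ≤ C ^ 2 * (4 * (1 + nsq m) ^ (ε - 1)) *
        ((1 + nsq (m - l)) ^ (-(1 + ε)) + (1 + nsq l) ^ (-(1 + ε))) := by
      intro l
      have i1 : K₁ (m - l) * K₂ l ≤
          (C * (1 + nsq (m - l)) ^ (-1 : ℝ)) * (C * (1 + nsq l) ^ (-1 : ℝ)) :=
        mul_le_mul (b1 _) (b2 _) (h2 _).le ((h1 _).le.trans (b1 _))
      have i2 := mul_le_mul_of_nonneg_left (aux_pt ε hε0 hε1 m l) (sq_nonneg C)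
      have i3 := hf l
      calc f l ≤ _ := i3
        _ ≤ _ := i1
        _ = C ^ 2 * ((1 + nsq (m - l)) ^ (-1 : ℝ) * (1 + nsq l) ^ (-1 : ℝ)) := by ring
        _ ≤ _ := i2
        _ = _ := by ring
    have hfs : Summable f := Summable.of_nonneg_of_le hf0 hle hg
    have hfin := hfs.tsum_le_tsum hle hg
    rw [tsum_mul_left, hS'.tsum_add hS, hSe] at hfin
    have hp : 0 < (1 + nsq m) ^ (ε - 1) := Real.rpow_pos_of_pos (hn m) _
    calc ∑' l, f l ≤ _ := hfin
      _ ≤ _ := by rw [← hSdef]; nlinarith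
  refine ⟨fun m => key m _ (fun l => (mul_pos (h1 _) (h2 _)).le) (fun l => le_rfl), ?_⟩
  intro N _ m
  refine key m _ (fun l => ?_) (fun l => ?_)
  · exact Set.indicator_nonneg (fun l _ => (mul_pos (h1 _) (h2 _)).le) l
  · exact Set.indicator_le_self' (fun _ _ => (mul_pos (h1 _) (h2 _)).le) l
end

section
/- Let α > 0 and β ∈ (0,1). There exists a constant C > 0, depending only on α and β, such that for every m ∈ ℤ², Σ_{l∈ℤ², |l| ≤ |m|/2} (1+|m−l|²)^{-α}·(1+|l|²)^{-β} ≤ C·(1+|m|²)^{1−α−β}. -/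
open scoped BigOperators

lemma step_aux (β : ℝ) (hβ0 : 0 < β) (hβ1 : β < 1) (x : ℝ) (hx : 1 ≤ x) :
    (x - 1) ^ (1 - β) + (1 - β) * x ^ (-β) ≤ x ^ (1 - β) := by
  have hx0 : 0 < x := by linarith
  have h1 : (1 + (-(1 / x))) ^ (1 - β) ≤ 1 + (1 - β) * (-(1 / x)) := by
    apply rpow_one_add_le_one_add_mul_self
    · have : 1 / x ≤ 1 := by rw [div_le_one hx0]; exact hx
      linarith
    · linarith
    · linarith
  have h2 : x - 1 = x * (1 + (-(1 / x))) := by field_simp; ring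
  have h3 : 0 ≤ 1 + (-(1 / x)) := by
    have : 1 / x ≤ 1 := by rw [div_le_one hx0]; exact hx
    linarith
  have h4 : x ^ (-β) = x ^ (1 - β) * (1 / x) := by
    rw [show -β = (1 - β) - 1 by ring, Real.rpow_sub_one hx0.ne']; ring
  have h5 : 0 < x ^ (1 - β) := Real.rpow_pos_of_pos hx0 _
  rw [h2, Real.mul_rpow hx0.le h3, h4]
  nlinarith [mul_le_mul_of_nonneg_left h1 h5.le]

lemma term_aux (β : ℝ) (hβ0 : 0 < β) (hβ1 : β < 1) (x : ℝ) (hx : 1 ≤ x) :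
    (1 + (x - 1) ^ 2) ^ (-(β / 2)) ≤ 2 * x ^ (-β) := by
  have hx0 : 0 < x := by linarith
  have h1 : (x / 2) ^ 2 ≤ 1 + (x - 1) ^ 2 := by nlinarith [sq_nonneg (3 * x - 4)]
  have h2 : (1 + (x - 1) ^ 2) ^ (-(β / 2)) ≤ ((x / 2) ^ 2) ^ (-(β / 2)) :=
    Real.rpow_le_rpow_of_nonpos (by positivity) h1 (by linarith)
  have h3 : ((x / 2) ^ 2) ^ (-(β / 2)) = 2 ^ β * x ^ (-β) := by
    rw [← Real.rpow_natCast, ← Real.rpow_mul (by positivity),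
      show ((2 : ℕ) : ℝ) * (-(β / 2)) = -β by push_cast; ring,
      Real.div_rpow hx0.le (by norm_num), Real.rpow_neg (by norm_num : (0 : ℝ) ≤ 2)]
    field_simp
  have h4 : (2 : ℝ) ^ β ≤ 2 := by
    calc (2 : ℝ) ^ β ≤ 2 ^ (1 : ℝ) := Real.rpow_le_rpow_of_exponent_le (by norm_num) hβ1.le
      _ = 2 := by norm_num
  rw [h3] at h2
  exact h2.trans (mul_le_mul_of_nonneg_right h4 (Real.rpow_nonneg hx0.le _))

lemma sum_aux (β : ℝ) (hβ0 : 0 < β) (hβ1 : β < 1) (K : ℕ) :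
    ∑ a ∈ Finset.Icc (-(K : ℤ)) K, (1 + (a : ℝ) ^ 2) ^ (-(β / 2))
      ≤ 4 / (1 - β) * ((K : ℝ) + 1) ^ (1 - β) := by
  have hb : 0 < 1 - β := by linarith
  induction K with
  | zero =>
    simp
    rw [le_div_iff₀ hb]; linarith
  | succ K ih =>
    have hI : Finset.Icc (-((K + 1 : ℕ) : ℤ)) ((K + 1 : ℕ) : ℤ)
        = insert ((K : ℤ) + 1) (insert (-((K : ℤ) + 1)) (Finset.Icc (-(K : ℤ)) K)) := by
      ext a; simp only [Finset.mem_Icc, Finset.mem_insert]; omega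
    rw [hI, Finset.sum_insert (by simp only [Finset.mem_Icc, Finset.mem_insert]; omega),
      Finset.sum_insert (by simp only [Finset.mem_Icc]; omega)]
    have hK : (0 : ℝ) ≤ K := Nat.cast_nonneg K
    have h1 := term_aux β hβ0 hβ1 (K + 2) (by linarith)
    have h2 := step_aux β hβ0 hβ1 (K + 2) (by linarith)
    rw [show (K : ℝ) + 2 - 1 = K + 1 by ring] at h1 h2
    push_cast
    rw [neg_sq, show (K : ℝ) + 1 + 1 = K + 2 by ring]
    have h3 := mul_le_mul_of_nonneg_left h2 (by positivity : 0 ≤ 4 / (1 - β))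
    have h4 : 4 / (1 - β) * ((1 - β) * ((K : ℝ) + 2) ^ (-β)) = 4 * ((K : ℝ) + 2) ^ (-β) := by
      field_simp
    rw [mul_add, h4] at h3
    linarith

lemma sep_aux (β : ℝ) (hβ0 : 0 < β) (a b : ℝ) :
    (1 + (a ^ 2 + b ^ 2)) ^ (-β) ≤ (1 + a ^ 2) ^ (-(β / 2)) * (1 + b ^ 2) ^ (-(β / 2)) := by
  rw [← Real.mul_rpow (by positivity) (by positivity)]
  have h : (1 + (a ^ 2 + b ^ 2)) ^ (-β) = ((1 + (a ^ 2 + b ^ 2)) ^ 2) ^ (-(β / 2)) := by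
    rw [← Real.rpow_natCast (1 + (a ^ 2 + b ^ 2)) 2, ← Real.rpow_mul (by positivity)]
    congr 1; push_cast; ring
  rw [h]
  apply Real.rpow_le_rpow_of_nonpos (by positivity) _ (by linarith)
  nlinarith [sq_nonneg a, sq_nonneg b, mul_nonneg (sq_nonneg a) (sq_nonneg b),
    sq_nonneg (a ^ 2), sq_nonneg (b ^ 2)]

lemma nsq_nonneg' (m : ℤ × ℤ) : 0 ≤ nsq m := by unfold nsq; positivity

lemma far_aux (m l : ℤ × ℤ) (h : norm2 l ≤ norm2 m / 2) :
    (1 + nsq m) / 4 ≤ 1 + nsq (m - l) := by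
  have hl := Real.sq_sqrt (nsq_nonneg' l)
  have hm := Real.sq_sqrt (nsq_nonneg' m)
  have hl0 := Real.sqrt_nonneg (nsq l)
  have hm0 := Real.sqrt_nonneg (nsq m)
  unfold norm2 at h
  set p := Real.sqrt (nsq l)
  set q := Real.sqrt (nsq m)
  have hcs : (m.1 : ℝ) * l.1 + (m.2 : ℝ) * l.2 ≤ q * p := by
    apply le_of_abs_le; apply abs_le_of_sq_le_sq _ (by positivity)
    rw [mul_pow, hl, hm]; unfold nsq
    nlinarith [sq_nonneg ((m.1 : ℝ) * l.2 - m.2 * l.1)]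
  have e : nsq (m - l) = q ^ 2 + p ^ 2 - 2 * ((m.1 : ℝ) * l.1 + (m.2 : ℝ) * l.2) := by
    rw [hl, hm]; unfold nsq; simp only [Prod.fst_sub, Prod.snd_sub]; push_cast; ring
  rw [e, ← hm]
  nlinarith [mul_self_nonneg (q / 2 - p), mul_nonneg (sub_nonneg.2 h) hm0]

theorem stmt_2 (α β : ℝ) (hα : 0 < α) (hβ0 : 0 < β) (hβ1 : β < 1) :
    ∃ C : ℝ, 0 < C ∧
      ∀ m : ℤ × ℤ,
        (∑' l : ℤ × ℤ,
            Set.indicator {l : ℤ × ℤ | norm2 l ≤ norm2 m / 2}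
              (fun l => (1 + nsq (m - l)) ^ (-α) * (1 + nsq l) ^ (-β)) l)
          ≤ C * (1 + nsq m) ^ (1 - α - β) := by
  have hb : 0 < 1 - β := by linarith
  refine ⟨4 ^ α * ((4 / (1 - β)) ^ 2 * 2), by positivity, fun m => ?_⟩
  have hm := nsq_nonneg' m
  have hq0 : 0 ≤ norm2 m := Real.sqrt_nonneg _
  have hq : norm2 m ^ 2 = nsq m := Real.sq_sqrt hm
  set K := ⌊norm2 m⌋₊ with hK
  set I := Finset.Icc (-(K : ℤ)) K with hI
  have coord : ∀ (z : ℤ), |(z : ℝ)| ≤ norm2 m → z ∈ I := by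
    intro z hz
    have : z.natAbs ≤ K := by
      apply Nat.le_floor
      rw [Nat.cast_natAbs]; push_cast; exact hz
    rw [hI, Finset.mem_Icc]; omega
  rw [tsum_eq_sum (s := I ×ˢ I)]
  · set A := 4 ^ α * (1 + nsq m) ^ (-α) with hA
    have hA0 : 0 ≤ A := by positivity
    have hbound : ∀ l ∈ I ×ˢ I, Set.indicator {l : ℤ × ℤ | norm2 l ≤ norm2 m / 2}
        (fun l => (1 + nsq (m - l)) ^ (-α) * (1 + nsq l) ^ (-β)) l ≤
        A * ((1 + (l.1 : ℝ) ^ 2) ^ (-(β / 2)) * (1 + (l.2 : ℝ) ^ 2) ^ (-(β / 2))) := by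
      intro l _
      apply Set.indicator_le' (s := {l : ℤ × ℤ | norm2 l ≤ norm2 m / 2})
        (g := fun l : ℤ × ℤ =>
          A * ((1 + (l.1 : ℝ) ^ 2) ^ (-(β / 2)) * (1 + (l.2 : ℝ) ^ 2) ^ (-(β / 2))))
      · intro l hl
        have h1 := far_aux m l hl
        have h2 : (1 + nsq (m - l)) ^ (-α) ≤ A := by
          calc (1 + nsq (m - l)) ^ (-α) ≤ ((1 + nsq m) / 4) ^ (-α) :=
                Real.rpow_le_rpow_of_nonpos (by positivity) h1 (by linarith)
            _ = A := by
                rw [Real.div_rpow (by positivity) (by norm_num),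
                  Real.rpow_neg (by norm_num : (0 : ℝ) ≤ 4), hA]
                field_simp
        have h3 := sep_aux β hβ0 l.1 l.2
        have h4 := nsq_nonneg' l
        exact mul_le_mul h2 h3 (Real.rpow_nonneg (by positivity) _) hA0
      · intro l _
        positivity
    refine (Finset.sum_le_sum hbound).trans ?_
    rw [← Finset.mul_sum, Finset.sum_product]
    simp only []
    rw [← Finset.sum_mul_sum]
    have hS := sum_aux β hβ0 hβ1 K
    rw [← hI] at hS
    set S := ∑ a ∈ I, (1 + (a : ℝ) ^ 2) ^ (-(β / 2))
    have hS0 : 0 ≤ S := Finset.sum_nonneg (fun a _ => by positivity)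
    have hS2 : S * S ≤ (4 / (1 - β)) ^ 2 * (((K : ℝ) + 1) ^ 2) ^ (1 - β) := by
      have := mul_le_mul hS hS hS0 (hS0.trans hS)
      refine this.trans (le_of_eq ?_)
      rw [sq ((K : ℝ) + 1), Real.mul_rpow (by positivity) (by positivity)]
      ring
    have hKq : (K : ℝ) ≤ norm2 m := Nat.floor_le hq0
    have hK2 : ((K : ℝ) + 1) ^ 2 ≤ 2 * (1 + nsq m) := by
      have hK0 : (0 : ℝ) ≤ K := Nat.cast_nonneg K
      nlinarith [sq_nonneg ((K : ℝ) - 1)]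
    have h5 : (((K : ℝ) + 1) ^ 2) ^ (1 - β) ≤ 2 * (1 + nsq m) ^ (1 - β) := by
      calc (((K : ℝ) + 1) ^ 2) ^ (1 - β) ≤ (2 * (1 + nsq m)) ^ (1 - β) :=
            Real.rpow_le_rpow (by positivity) hK2 hb.le
        _ = 2 ^ (1 - β) * (1 + nsq m) ^ (1 - β) := Real.mul_rpow (by norm_num) (by positivity)
        _ ≤ 2 * (1 + nsq m) ^ (1 - β) := by
            apply mul_le_mul_of_nonneg_right _ (by positivity)
            calc (2 : ℝ) ^ (1 - β) ≤ 2 ^ (1 : ℝ) :=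
                  Real.rpow_le_rpow_of_exponent_le (by norm_num) (by linarith)
              _ = 2 := by norm_num
    calc A * (S * S) ≤ A * ((4 / (1 - β)) ^ 2 * (2 * (1 + nsq m) ^ (1 - β))) := by
          apply mul_le_mul_of_nonneg_left _ hA0
          exact hS2.trans (mul_le_mul_of_nonneg_left h5 (by positivity))
      _ = _ := by
          rw [hA, show 1 - α - β = -α + (1 - β) by ring,
            Real.rpow_add (by positivity : 0 < 1 + nsq m)]
          ring
  · intro l hl
    apply Set.indicator_of_notMem
    intro h
    apply hl
    have h' : norm2 l ≤ norm2 m := by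
      have : norm2 l ≤ norm2 m / 2 := h
      linarith
    rw [Finset.mem_product]
    constructor
    · apply coord
      refine le_trans ?_ h'
      apply Real.abs_le_sqrt
      unfold nsq; nlinarith [sq_nonneg (l.2 : ℝ)]
    · apply coord
      refine le_trans ?_ h'
      apply Real.abs_le_sqrt
      unfold nsq; nlinarith [sq_nonneg (l.1 : ℝ)]
end

section
/- Let n ≥ 1 be an integer, let γ ∈ (0, 1/n), let C > 0, and let K : ℤ² → (0,∞) be a kernel satisfying K(m) ≤ C·(1+|m|²)^{γ−1} for all m ∈ ℤ². Then there exists a constant C' > 0, depending only on C, n, γ, such that for every m ∈ ℤ², K⋆ⁿK(m) ≤ C'·(1+|m|²)^{nγ−1} and sup_{N≥1} K⋆ⁿ_{≤N}K(m) ≤ C'·(1+|m|²)^{nγ−1}. -/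
open scoped BigOperators

/-- Convolution of two kernels on `ℤ²`: `K₁⋆K₂(m) = Σ_{l∈ℤ²} K₁(m−l)K₂(l)`. -/
noncomputable def conv (K₁ K₂ : ℤ × ℤ → ℝ) (m : ℤ × ℤ) : ℝ :=
  ∑' l : ℤ × ℤ, K₁ (m - l) * K₂ l

/-- Truncated convolution: `K₁⋆_{≤N}K₂(m) = Σ_{|l|≤N} K₁(m−l)K₂(l)`. -/
noncomputable def convLE (N : ℕ) (K₁ K₂ : ℤ × ℤ → ℝ) (m : ℤ × ℤ) : ℝ :=
  ∑' l : ℤ × ℤ,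
    Set.indicator {l : ℤ × ℤ | norm2 l ≤ (N : ℝ)} (fun l => K₁ (m - l) * K₂ l) l

/-- Iterated convolution `K⋆ⁿK`, with `K⋆¹K = K` and `K⋆ⁿK = K⋆(K⋆ⁿ⁻¹K)`. -/
noncomputable def iterConv (K : ℤ × ℤ → ℝ) : ℕ → ℤ × ℤ → ℝ
  | 0 => fun _ => 0
  | 1 => K
  | (n + 2) => conv K (iterConv K (n + 1))

/-- Truncated iterated convolution `K⋆ⁿ_{≤N}K`, with `K⋆¹_{≤N}K = K` and
`K⋆ⁿ_{≤N}K = K⋆_{≤N}(K⋆ⁿ⁻¹_{≤N}K)`. -/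
noncomputable def iterConvLE (N : ℕ) (K : ℤ × ℤ → ℝ) : ℕ → ℤ × ℤ → ℝ
  | 0 => fun _ => 0
  | 1 => K
  | (n + 2) => convLE N K (iterConvLE N K (n + 1))

/-- Tail of the iterated convolution: `K⋆ⁿ_{>N}K = K⋆ⁿK − K⋆ⁿ_{≤N}K`. -/
noncomputable def iterConvGT (N : ℕ) (K : ℤ × ℤ → ℝ) (n : ℕ) (m : ℤ × ℤ) : ℝ :=
  iterConv K n m - iterConvLE N K n m

open scoped ENNReal

/-- The integer weight `1 + |m|²`. -/
def wN (m : ℤ × ℤ) : ℕ := 1 + m.1.natAbs ^ 2 + m.2.natAbs ^ 2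

lemma wN_cast (m : ℤ × ℤ) : (wN m : ℝ) = 1 + nsq m := by
  simp only [wN, nsq]; push_cast
  simp only [Nat.cast_natAbs, Int.cast_abs, sq_abs]; ring

lemma wN_pos (m : ℤ × ℤ) : 1 ≤ wN m := by unfold wN; omega

lemma wN_tri (m l : ℤ × ℤ) : wN m ≤ 2 * (wN (m - l) + wN l) := by
  have h : (wN m : ℝ) ≤ 2 * (wN (m - l) + wN l) := by
    simp only [wN_cast, nsq, Prod.fst_sub, Prod.snd_sub]; push_cast
    nlinarith [sq_nonneg ((m.1:ℝ) - 2 * l.1), sq_nonneg ((m.2:ℝ) - 2 * l.2)]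
  exact_mod_cast h

lemma count_le (j : ℕ) :
    ∑' l : ℤ × ℤ, (if wN l ≤ 2 ^ j then (1 : ℝ≥0∞) else 0) ≤ 9 * 2 ^ j := by
  set s := Nat.sqrt (2 ^ j) with hs
  have hs1 : 1 ≤ s := by
    rw [hs, Nat.le_sqrt]; simpa using Nat.one_le_two_pow
  have hs2 : s * s ≤ 2 ^ j := Nat.sqrt_le _
  let B : Finset (ℤ × ℤ) := Finset.Icc (-(s:ℤ)) s ×ˢ Finset.Icc (-(s:ℤ)) s
  have hsub : ∀ l, l ∉ B → (if wN l ≤ 2 ^ j then (1 : ℝ≥0∞) else 0) = 0 := by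
    intro l hl
    rw [if_neg]
    intro h
    apply hl
    unfold wN at h
    have h1 : l.1.natAbs ≤ s := by rw [hs, Nat.le_sqrt]; nlinarith
    have h2 : l.2.natAbs ≤ s := by rw [hs, Nat.le_sqrt]; nlinarith
    simp only [B, Finset.mem_product, Finset.mem_Icc]
    omega
  rw [tsum_eq_sum (fun l hl => hsub l hl)]
  calc ∑ l ∈ B, (if wN l ≤ 2 ^ j then (1 : ℝ≥0∞) else 0) ≤ ∑ l ∈ B, (1 : ℝ≥0∞) := by
        apply Finset.sum_le_sum; intro l _; split_ifs <;> simp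
    _ = (B.card : ℝ≥0∞) := by simp
    _ ≤ ((9 * 2 ^ j : ℕ) : ℝ≥0∞) := by
        apply Nat.cast_le.mpr
        simp only [B, Finset.card_product, Int.card_Icc]
        have : ((s:ℤ) + 1 - -(s:ℤ)).toNat = 2 * s + 1 := by omega
        rw [this]; nlinarith
    _ = 9 * 2 ^ j := by push_cast; rfl

lemma count_le' (m : ℤ × ℤ) (j : ℕ) :
    ∑' l : ℤ × ℤ, (if wN (m - l) ≤ 2 ^ j then (1 : ℝ≥0∞) else 0) ≤ 9 * 2 ^ j := by
  have := (Equiv.subLeft m).tsum_eq (fun l => if wN l ≤ 2 ^ j then (1 : ℝ≥0∞) else 0)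
  simp only [Equiv.subLeft_apply] at this
  rw [this]; exact count_le j

/-- one-sided piece of the joint count bound -/
noncomputable def T (M j k : ℕ) : ℝ≥0∞ := if j ≤ k ∧ M ≤ 4 * 2 ^ k then 2 ^ j else 0

lemma joint_count (m : ℤ × ℤ) (j k : ℕ) :
    ∑' l : ℤ × ℤ, (if wN (m - l) ≤ 2 ^ j ∧ wN l ≤ 2 ^ k then (1 : ℝ≥0∞) else 0)
      ≤ 9 * (T (wN m) j k + T (wN m) k j) := by
  by_cases hM : wN m ≤ 4 * 2 ^ (max j k)
  · rcases le_total j k with h | h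
    · rw [max_eq_right h] at hM
      calc _ ≤ ∑' l : ℤ × ℤ, (if wN (m - l) ≤ 2 ^ j then (1 : ℝ≥0∞) else 0) := by
            apply ENNReal.tsum_le_tsum; intro l
            split_ifs with h1 h2 <;> simp_all
        _ ≤ 9 * 2 ^ j := count_le' m j
        _ = 9 * T (wN m) j k := by simp [T, h, hM]
        _ ≤ _ := by gcongr; exact le_self_add
    · rw [max_eq_left h] at hM
      calc _ ≤ ∑' l : ℤ × ℤ, (if wN l ≤ 2 ^ k then (1 : ℝ≥0∞) else 0) := by
            apply ENNReal.tsum_le_tsum; intro l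
            split_ifs with h1 h2 <;> simp_all
        _ ≤ 9 * 2 ^ k := count_le k
        _ = 9 * T (wN m) k j := by simp [T, h, hM]
        _ ≤ _ := by gcongr; exact le_add_self
  · have : ∀ l : ℤ × ℤ,
        (if wN (m - l) ≤ 2 ^ j ∧ wN l ≤ 2 ^ k then (1 : ℝ≥0∞) else 0) = 0 := by
      intro l
      rw [if_neg]
      rintro ⟨h1, h2⟩
      apply hM
      have h3 := wN_tri m l
      have h4 : 2 ^ j ≤ 2 ^ (max j k) := Nat.pow_le_pow_right (by norm_num) (le_max_left _ _)
      have h5 : 2 ^ k ≤ 2 ^ (max j k) := Nat.pow_le_pow_right (by norm_num) (le_max_right _ _)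
      omega
    simp [this]

lemma layer (p : ℝ) (hp : 0 < p) (w : ℕ) (hw : 1 ≤ w) :
    ∃ k : ℕ, w ≤ 2 ^ k ∧ (w : ℝ) ^ (-p) ≤ 2 ^ p * ((2 : ℝ) ^ (-p)) ^ k := by
  refine ⟨Nat.clog 2 w, Nat.le_pow_clog (by norm_num) w, ?_⟩
  set k := Nat.clog 2 w with hk
  have h2 : (2:ℝ) ^ k ≤ 2 * w := by
    rcases Nat.lt_or_ge 1 w with h | h
    · have h3 := Nat.pow_pred_clog_lt_self (b := 2) (by norm_num) h
      have h4 : 0 < Nat.clog 2 w := Nat.clog_pos (by norm_num) h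
      have h5 : 2 ^ k = 2 * 2 ^ (Nat.clog 2 w).pred := by
        rw [← pow_succ']; congr 1; rw [hk, Nat.pred_eq_sub_one]; omega
      have : 2 ^ k ≤ 2 * w := by omega
      exact_mod_cast this
    · have : w = 1 := le_antisymm h hw
      simp [hk, this]
  have hw0 : (0:ℝ) < w := by exact_mod_cast hw
  have e : (2:ℝ) ^ p * ((2 : ℝ) ^ (-p)) ^ k = ((2:ℝ) ^ k / 2) ^ (-p) := by
    rw [Real.div_rpow (by positivity) (by norm_num), Real.rpow_neg (by norm_num : (0:ℝ) ≤ 2),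
      Real.rpow_neg (by positivity : (0:ℝ) ≤ 2 ^ k),
      ← Real.rpow_natCast_mul (by norm_num), mul_comm (k:ℝ) p, Real.rpow_mul_natCast (by norm_num), inv_pow]
    field_simp
  rw [e]
  exact Real.rpow_le_rpow_of_nonpos (by positivity) (by linarith) (by linarith)

lemma geom_T (A b ρ : ℝ≥0∞) (hA : 1 < A) (hAt : A ≠ ⊤) (hρ : A * b = ρ) (M k : ℕ) :
    ∑' j : ℕ, (A / 2) ^ j * b ^ k * T M j k ≤
      (1 - A⁻¹)⁻¹ * (if M ≤ 4 * 2 ^ k then ρ ^ k else 0) := by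
  by_cases hM : M ≤ 4 * 2 ^ k
  · have hz : ∀ j ∉ Finset.range (k+1), (A / 2) ^ j * b ^ k * T M j k = 0 := by
      intro j hj
      have : ¬ j ≤ k := by simpa using hj
      simp [T, this]
    rw [tsum_eq_sum hz, if_pos hM]
    have h1 : ∀ j ∈ Finset.range (k+1), (A / 2) ^ j * b ^ k * T M j k = A ^ j * b ^ k := by
      intro j hj
      have : j ≤ k := by simpa [Nat.lt_succ_iff] using hj
      rw [T, if_pos ⟨this, hM⟩, mul_right_comm, ← mul_pow,
        ENNReal.div_mul_cancel (by norm_num) (by norm_num)]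
    rw [Finset.sum_congr rfl h1, ← Finset.sum_mul, ← Finset.sum_range_reflect, ← hρ, mul_pow,
      ← mul_assoc]
    gcongr
    calc ∑ j ∈ Finset.range (k+1), A ^ (k + 1 - 1 - j)
        = ∑ j ∈ Finset.range (k+1), A ^ k * A⁻¹ ^ j := by
          apply Finset.sum_congr rfl
          intro j hj
          have hj : j ≤ k := by simpa [Nat.lt_succ_iff] using hj
          have hA0 : A ≠ 0 := by rintro rfl; simp at hA
          have : A ^ k = A ^ (k - j) * A ^ j := by rw [← pow_add]; congr 1; omega
          rw [this, mul_assoc, ← mul_pow, ENNReal.mul_inv_cancel hA0 hAt]; simp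
      _ = A ^ k * ∑ j ∈ Finset.range (k+1), A⁻¹ ^ j := by rw [Finset.mul_sum]
      _ ≤ A ^ k * ∑' j, A⁻¹ ^ j := by gcongr; exact ENNReal.sum_le_tsum _
      _ = _ := by rw [ENNReal.tsum_geometric, mul_comm]
  · simp [T, hM]

lemma exists_first (M : ℕ) : ∃ k0, M ≤ 4 * 2 ^ k0 ∧ ∀ i < k0, ¬ M ≤ 4 * 2 ^ i := by
  classical
  have hex : ∃ k, M ≤ 4 * 2 ^ k := ⟨M, by have := @Nat.lt_two_pow_self M; omega⟩
  exact ⟨Nat.find hex, Nat.find_spec hex, fun i hi => Nat.find_min hex hi⟩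

lemma tail_pow (δ : ℝ) (hδ : 0 < δ) (M k0 : ℕ) (hM : 1 ≤ M) (hk0 : M ≤ 4 * 2 ^ k0) :
    ((2 : ℝ) ^ (-δ)) ^ k0 ≤ 4 ^ δ * (M : ℝ) ^ (-δ) := by
  have hM0 : (0:ℝ) < M := by exact_mod_cast hM
  have h1 : (M:ℝ) ≤ 4 * 2 ^ k0 := by exact_mod_cast hk0
  have e : ((2 : ℝ) ^ (-δ)) ^ k0 = 4 ^ δ * (4 * (2:ℝ) ^ k0) ^ (-δ) := by
    rw [Real.mul_rpow (by norm_num) (by positivity), ← mul_assoc,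
      ← Real.rpow_add (by norm_num), add_neg_cancel, Real.rpow_zero, one_mul,
      ← Real.rpow_natCast_mul (by norm_num), mul_comm (k0:ℝ), Real.rpow_mul_natCast (by norm_num)]
  rw [e]
  exact mul_le_mul_of_nonneg_left (Real.rpow_le_rpow_of_nonpos hM0 h1 (by linarith))
    (by positivity)

lemma tail_geom (ρ : ℝ≥0∞) (P : ℕ → Prop) [DecidablePred P] (k0 : ℕ) (hmin : ∀ i < k0, ¬ P i) :
    ∑' k : ℕ, (if P k then ρ ^ k else 0) ≤ (1 - ρ)⁻¹ * ρ ^ k0 := by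
  have hsplit := Summable.sum_add_tsum_nat_add' (k := k0)
    (f := fun k : ℕ => if P k then ρ ^ k else 0) ENNReal.summable
  have hz : ∑ i ∈ Finset.range k0, (if P i then ρ ^ i else 0) = 0 := by
    apply Finset.sum_eq_zero
    intro i hi
    rw [if_neg (hmin i (Finset.mem_range.mp hi))]
  rw [← hsplit, hz, zero_add, ← ENNReal.tsum_geometric, ← ENNReal.tsum_mul_right]
  apply ENNReal.tsum_le_tsum
  intro i
  rw [← pow_add]
  split_ifs
  · exact le_rfl
  · exact zero_le

lemma tail_sum (δ : ℝ) (hδ : 0 < δ) (M : ℕ) (hM : 1 ≤ M) :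
    ∑' k : ℕ, (if M ≤ 4 * 2 ^ k then (ENNReal.ofReal ((2:ℝ) ^ (-δ))) ^ k else 0) ≤
      (1 - ENNReal.ofReal ((2:ℝ) ^ (-δ)))⁻¹ * ENNReal.ofReal (4 ^ δ * (M : ℝ) ^ (-δ)) := by
  obtain ⟨k0, hk0, hmin⟩ := exists_first M
  have hpow : ENNReal.ofReal ((2:ℝ) ^ (-δ)) ^ k0 ≤ ENNReal.ofReal (4 ^ δ * (M : ℝ) ^ (-δ)) := by
    rw [← ENNReal.ofReal_pow (by positivity)]
    exact ENNReal.ofReal_le_ofReal (tail_pow δ hδ M k0 hM hk0)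
  exact (tail_geom _ (fun k => M ≤ 4 * 2 ^ k) k0 hmin).trans (mul_le_mul_right hpow _)

lemma half_sum (α β : ℝ) (hα : 0 < α) (hαβ : α + β < 1) :
    ∃ A : ℝ≥0∞, A ≠ ⊤ ∧ ∀ M : ℕ, 1 ≤ M →
      ∑' k : ℕ, ∑' j : ℕ, ENNReal.ofReal ((2:ℝ) ^ (-(1 - α))) ^ j *
        ENNReal.ofReal ((2:ℝ) ^ (-(1 - β))) ^ k * T M j k ≤
        A * ENNReal.ofReal ((M:ℝ) ^ (α + β - 1)) := by
  set A := ENNReal.ofReal ((2:ℝ) ^ α) with hA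
  set ρ := ENNReal.ofReal ((2:ℝ) ^ (-(1 - α - β))) with hρ
  have hA1 : 1 < A := by
    rw [hA, ENNReal.one_lt_ofReal]; exact Real.one_lt_rpow (by norm_num) hα
  have hρ1 : ρ < 1 := by
    rw [hρ, ENNReal.ofReal_lt_one]; exact Real.rpow_lt_one_of_one_lt_of_neg (by norm_num) (by linarith)
  have hAt : A ≠ ⊤ := ENNReal.ofReal_ne_top
  have e1 : ENNReal.ofReal ((2:ℝ) ^ (-(1 - α))) = A / 2 := by
    rw [hA, show (2:ℝ≥0∞) = ENNReal.ofReal 2 by simp, ← ENNReal.ofReal_div_of_pos (by norm_num)]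
    congr 1
    rw [show -(1 - α) = α - 1 by ring, Real.rpow_sub_one (by norm_num)]
  have e2 : A * ENNReal.ofReal ((2:ℝ) ^ (-(1 - β))) = ρ := by
    rw [hA, hρ, ← ENNReal.ofReal_mul (by positivity), ← Real.rpow_add (by norm_num)]
    congr 2; ring
  refine ⟨(1 - A⁻¹)⁻¹ * ((1 - ρ)⁻¹ * ENNReal.ofReal (4 ^ (1 - α - β))), ?_, ?_⟩
  · refine ENNReal.mul_ne_top ?_ (ENNReal.mul_ne_top ?_ ENNReal.ofReal_ne_top)
    · rw [ENNReal.inv_ne_top]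
      exact (tsub_pos_of_lt (ENNReal.inv_lt_one.mpr hA1)).ne'
    · rw [ENNReal.inv_ne_top]
      exact (tsub_pos_of_lt hρ1).ne'
  · intro M hM
    rw [e1]
    calc _ ≤ ∑' k : ℕ, (1 - A⁻¹)⁻¹ * (if M ≤ 4 * 2 ^ k then ρ ^ k else 0) :=
          ENNReal.tsum_le_tsum (fun k => geom_T A _ ρ hA1 hAt e2 M k)
      _ = (1 - A⁻¹)⁻¹ * ∑' k : ℕ, (if M ≤ 4 * 2 ^ k then ρ ^ k else 0) := ENNReal.tsum_mul_left
      _ ≤ (1 - A⁻¹)⁻¹ * ((1 - ρ)⁻¹ *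
            ENNReal.ofReal (4 ^ (1 - α - β) * (M:ℝ) ^ (-(1 - α - β)))) := by
          gcongr; exact tail_sum _ (by linarith) M hM
      _ = _ := by
          rw [ENNReal.ofReal_mul (by positivity), show -(1 - α - β) = α + β - 1 by ring]
          ring

lemma key_enn (α β : ℝ) (hα : 0 < α) (hβ : 0 < β) (hαβ : α + β < 1) :
    ∃ A : ℝ≥0∞, A ≠ ⊤ ∧ ∀ m : ℤ × ℤ,
      ∑' l : ℤ × ℤ, ENNReal.ofReal ((wN (m - l) : ℝ) ^ (α - 1) * (wN l : ℝ) ^ (β - 1)) ≤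
        A * ENNReal.ofReal ((wN m : ℝ) ^ (α + β - 1)) := by
  obtain ⟨A1, hA1, h1⟩ := half_sum α β hα hαβ
  obtain ⟨A2, hA2, h2⟩ := half_sum β α hβ (by linarith)
  set a := ENNReal.ofReal ((2:ℝ) ^ (-(1 - α))) with ha
  set b := ENNReal.ofReal ((2:ℝ) ^ (-(1 - β))) with hb
  set c := ENNReal.ofReal ((2:ℝ) ^ (1 - α) * (2:ℝ) ^ (1 - β)) with hc
  refine ⟨c * (9 * (A1 + A2)), ?_, ?_⟩
  · exact ENNReal.mul_ne_top ENNReal.ofReal_ne_top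
      (ENNReal.mul_ne_top (by norm_num) (ENNReal.add_ne_top.mpr ⟨hA1, hA2⟩))
  intro m
  have hpt : ∀ l : ℤ × ℤ,
      ENNReal.ofReal ((wN (m - l) : ℝ) ^ (α - 1) * (wN l : ℝ) ^ (β - 1)) ≤
      c * ∑' k : ℕ, ∑' j : ℕ, a ^ j * b ^ k *
        (if wN (m - l) ≤ 2 ^ j ∧ wN l ≤ 2 ^ k then (1 : ℝ≥0∞) else 0) := by
    intro l
    obtain ⟨j, hj, hj'⟩ := layer (1 - α) (by linarith) _ (wN_pos (m - l))
    obtain ⟨k, hk, hk'⟩ := layer (1 - β) (by linarith) _ (wN_pos l)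
    calc _ ≤ ENNReal.ofReal ((2 ^ (1 - α) * ((2 : ℝ) ^ (-(1 - α))) ^ j) *
              (2 ^ (1 - β) * ((2 : ℝ) ^ (-(1 - β))) ^ k)) := by
          apply ENNReal.ofReal_le_ofReal
          rw [show α - 1 = -(1 - α) by ring, show β - 1 = -(1 - β) by ring]
          gcongr
      _ = c * (a ^ j * b ^ k) := by
          rw [ha, hb, hc, ← ENNReal.ofReal_pow (by positivity), ← ENNReal.ofReal_pow (by positivity),
            ← ENNReal.ofReal_mul (by positivity), ← ENNReal.ofReal_mul (by positivity)]
          congr 1; ring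
      _ = c * (a ^ j * b ^ k *
            (if wN (m - l) ≤ 2 ^ j ∧ wN l ≤ 2 ^ k then (1 : ℝ≥0∞) else 0)) := by
          rw [if_pos ⟨hj, hk⟩, mul_one]
      _ ≤ _ := by
          gcongr
          refine le_trans ?_ (ENNReal.le_tsum k)
          exact ENNReal.le_tsum (f := fun j => a ^ j * b ^ k *
            (if wN (m - l) ≤ 2 ^ j ∧ wN l ≤ 2 ^ k then (1 : ℝ≥0∞) else 0)) j
  have hM := wN_pos m
  calc _ ≤ ∑' l : ℤ × ℤ, c * ∑' k : ℕ, ∑' j : ℕ, a ^ j * b ^ k *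
        (if wN (m - l) ≤ 2 ^ j ∧ wN l ≤ 2 ^ k then (1 : ℝ≥0∞) else 0) :=
        ENNReal.tsum_le_tsum hpt
    _ = c * ∑' k : ℕ, ∑' j : ℕ, a ^ j * b ^ k * ∑' l : ℤ × ℤ,
        (if wN (m - l) ≤ 2 ^ j ∧ wN l ≤ 2 ^ k then (1 : ℝ≥0∞) else 0) := by
        rw [ENNReal.tsum_mul_left, ENNReal.tsum_comm]
        congr 1
        apply tsum_congr; intro k
        rw [ENNReal.tsum_comm]
        apply tsum_congr; intro j
        rw [ENNReal.tsum_mul_left]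
    _ ≤ c * ∑' k : ℕ, ∑' j : ℕ, a ^ j * b ^ k * (9 * (T (wN m) j k + T (wN m) k j)) := by
        gcongr with k j
        exact joint_count m j k
    _ = c * (9 * (∑' k : ℕ, ∑' j : ℕ, a ^ j * b ^ k * T (wN m) j k +
          ∑' j : ℕ, ∑' k : ℕ, b ^ k * a ^ j * T (wN m) k j)) := by
        rw [ENNReal.tsum_comm (f := fun j k => b ^ k * a ^ j * T (wN m) k j), ← ENNReal.tsum_add]
        congr 1
        rw [← ENNReal.tsum_mul_left]
        apply tsum_congr; intro k
        rw [← ENNReal.tsum_add, ← ENNReal.tsum_mul_left]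
        apply tsum_congr; intro j
        ring
    _ ≤ c * (9 * (A1 * ENNReal.ofReal ((wN m : ℝ) ^ (α + β - 1)) +
          A2 * ENNReal.ofReal ((wN m : ℝ) ^ (β + α - 1)))) := by
        gcongr
        · exact h1 _ hM
        · exact h2 _ hM
    _ = _ := by rw [add_comm β α]; ring

lemma key (α β : ℝ) (hα : 0 < α) (hβ : 0 < β) (hαβ : α + β < 1) :
    ∃ A : ℝ, 0 < A ∧ ∀ m : ℤ × ℤ,
      Summable (fun l : ℤ × ℤ => (1 + nsq (m - l)) ^ (α - 1) * (1 + nsq l) ^ (β - 1)) ∧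
      ∑' l : ℤ × ℤ, (1 + nsq (m - l)) ^ (α - 1) * (1 + nsq l) ^ (β - 1) ≤
        A * (1 + nsq m) ^ (α + β - 1) := by
  obtain ⟨A, hA, h⟩ := key_enn α β hα hβ hαβ
  refine ⟨A.toReal + 1, by positivity, ?_⟩
  intro m
  simp only [← wN_cast]
  have hm := h m
  have hR : A * ENNReal.ofReal ((wN m : ℝ) ^ (α + β - 1)) ≠ ⊤ :=
    ENNReal.mul_ne_top hA ENNReal.ofReal_ne_top
  have hL := ne_top_of_le_ne_top hR hm
  have hs := ENNReal.summable_toReal hL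
  have hnn : ∀ l, (ENNReal.ofReal ((wN (m - l) : ℝ) ^ (α - 1) * (wN l : ℝ) ^ (β - 1))).toReal =
      (wN (m - l) : ℝ) ^ (α - 1) * (wN l : ℝ) ^ (β - 1) :=
    fun l => ENNReal.toReal_ofReal (by positivity)
  have ht := ENNReal.toReal_mono hR hm
  rw [ENNReal.tsum_toReal_eq (fun l => ENNReal.ofReal_ne_top), ENNReal.toReal_mul,
    ENNReal.toReal_ofReal (by positivity)] at ht
  simp only [hnn] at hs ht
  refine ⟨hs, ht.trans ?_⟩
  gcongr
  linarith

lemma one_add_nsq_pos (m : ℤ × ℤ) : 0 < 1 + nsq m := by unfold nsq; positivity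

/-- Domination: any nonnegative function below the product of majorants has a controlled sum. -/
lemma dom (α β : ℝ) (A C C1 : ℝ) (hC : 0 < C) (hC1 : 0 < C1) (m : ℤ × ℤ)
    (hs : Summable (fun l : ℤ × ℤ => (1 + nsq (m - l)) ^ (α - 1) * (1 + nsq l) ^ (β - 1)))
    (ht : ∑' l : ℤ × ℤ, (1 + nsq (m - l)) ^ (α - 1) * (1 + nsq l) ^ (β - 1) ≤
        A * (1 + nsq m) ^ (α + β - 1))
    (f : ℤ × ℤ → ℝ) (hf0 : ∀ l, 0 ≤ f l)
    (hf : ∀ l, f l ≤ (C * (1 + nsq (m - l)) ^ (α - 1)) * (C1 * (1 + nsq l) ^ (β - 1))) :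
    ∑' l, f l ≤ C * C1 * A * (1 + nsq m) ^ (α + β - 1) := by
  have hs' := hs.mul_left (C * C1)
  have hf' : ∀ l, f l ≤ C * C1 * ((1 + nsq (m - l)) ^ (α - 1) * (1 + nsq l) ^ (β - 1)) :=
    fun l => (hf l).trans (le_of_eq (by ring))
  have hsf := Summable.of_nonneg_of_le hf0 hf' hs'
  calc _ ≤ _ := hsf.tsum_le_tsum hf' hs'
    _ = C * C1 * _ := tsum_mul_left
    _ ≤ C * C1 * (A * (1 + nsq m) ^ (α + β - 1)) := by gcongr
    _ = _ := by ring

lemma main_ind (γ : ℝ) (hγ0 : 0 < γ) (C : ℝ) (hC : 0 < C) (n : ℕ)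
    (hγn : ((n + 1 : ℕ) : ℝ) * γ < 1) :
    ∃ C' : ℝ, 0 < C' ∧
      ∀ K : ℤ × ℤ → ℝ, (∀ m, 0 < K m) → (∀ m, K m ≤ C * (1 + nsq m) ^ (γ - 1)) →
        ∀ m : ℤ × ℤ,
          (0 ≤ iterConv K (n+1) m ∧
            iterConv K (n+1) m ≤ C' * (1 + nsq m) ^ (((n + 1 : ℕ) : ℝ) * γ - 1)) ∧
          ∀ N : ℕ, 0 ≤ iterConvLE N K (n+1) m ∧
            iterConvLE N K (n+1) m ≤ C' * (1 + nsq m) ^ (((n + 1 : ℕ) : ℝ) * γ - 1) := by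
  induction n with
  | zero =>
    refine ⟨C, hC, ?_⟩
    intro K hK hKC m
    simp only [zero_add, iterConv, iterConvLE, Nat.cast_one, one_mul]
    exact ⟨⟨(hK m).le, hKC m⟩, fun _ => ⟨(hK m).le, hKC m⟩⟩
  | succ n ih =>
    obtain ⟨C1, hC1, h1⟩ := ih (by push_cast at hγn ⊢; linarith)
    obtain ⟨A, hA, hk⟩ := key γ (((n + 1 : ℕ) : ℝ) * γ) hγ0 (by positivity)
      (by push_cast at hγn ⊢; linarith)
    refine ⟨C * C1 * A, by positivity, ?_⟩
    intro K hK hKC m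
    obtain ⟨hs, ht⟩ := hk m
    have e : ((n + 1 + 1 : ℕ) : ℝ) * γ - 1 = γ + ((n + 1 : ℕ) : ℝ) * γ - 1 := by
      push_cast; ring
    rw [e]
    have hmul : ∀ (g : ℤ × ℤ → ℝ) (l : ℤ × ℤ), 0 ≤ g l →
        g l ≤ C1 * (1 + nsq l) ^ (((n + 1 : ℕ) : ℝ) * γ - 1) →
        K (m - l) * g l ≤ (C * (1 + nsq (m - l)) ^ (γ - 1)) *
          (C1 * (1 + nsq l) ^ (((n + 1 : ℕ) : ℝ) * γ - 1)) := by
      intro g l h0 hle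
      exact mul_le_mul (hKC _) hle h0 (le_trans (hK _).le (hKC _))
    refine ⟨?_, fun N => ?_⟩
    · have h0 : ∀ l, 0 ≤ K (m - l) * iterConv K (n+1) l :=
        fun l => mul_nonneg (hK _).le (h1 K hK hKC l).1.1
      simp only [iterConv, conv]
      refine ⟨tsum_nonneg h0, dom γ _ A C C1 hC hC1 m hs ht _ h0 ?_⟩
      exact fun l => hmul _ l (h1 K hK hKC l).1.1 (h1 K hK hKC l).1.2
    · have h0 : ∀ l, 0 ≤ K (m - l) * iterConvLE N K (n+1) l :=
        fun l => mul_nonneg (hK _).le ((h1 K hK hKC l).2 N).1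
      have h0' : ∀ l, 0 ≤ Set.indicator {l : ℤ × ℤ | norm2 l ≤ (N : ℝ)}
          (fun l => K (m - l) * iterConvLE N K (n+1) l) l :=
        fun l => Set.indicator_nonneg (fun l _ => h0 l) l
      simp only [iterConvLE, convLE]
      refine ⟨tsum_nonneg h0', dom γ _ A C C1 hC hC1 m hs ht _ h0' ?_⟩
      intro l
      refine le_trans (Set.indicator_le_self' (fun l _ => h0 l) l) ?_
      exact hmul _ l ((h1 K hK hKC l).2 N).1 ((h1 K hK hKC l).2 N).2

theorem stmt_8 (n : ℕ) (hn : 1 ≤ n) (γ : ℝ) (hγ0 : 0 < γ) (hγn : γ < 1 / (n : ℝ))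
    (C : ℝ) (hC : 0 < C) :
    ∃ C' : ℝ, 0 < C' ∧
      ∀ K : ℤ × ℤ → ℝ,
        (∀ m, 0 < K m) →
        (∀ m, K m ≤ C * (1 + nsq m) ^ (γ - 1)) →
        ∀ m : ℤ × ℤ,
          iterConv K n m ≤ C' * (1 + nsq m) ^ ((n : ℝ) * γ - 1) ∧
          ∀ N : ℕ, 1 ≤ N → iterConvLE N K n m ≤ C' * (1 + nsq m) ^ ((n : ℝ) * γ - 1) := by
  obtain ⟨k, rfl⟩ : ∃ k, n = k + 1 := ⟨n - 1, by omega⟩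
  have hk : ((k + 1 : ℕ) : ℝ) * γ < 1 := by
    rwa [lt_div_iff₀ (by positivity), mul_comm] at hγn
  obtain ⟨C', hC', h⟩ := main_ind γ hγ0 C hC k hk
  exact ⟨C', hC', fun K hK hKC m =>
    ⟨(h K hK hKC m).1.2, fun N _ => ((h K hK hKC m).2 N).2⟩⟩
end

section
/- Let n ≥ 2 be an integer, let γ ∈ (0, 1/n), let C > 0, and let K : ℤ² → (0,∞) be a kernel satisfying K(m) ≤ C·(1+|m|²)^{γ−1} for all m ∈ ℤ². Then there exists a constant C' > 0, depending only on C, n, γ, such that for every N ≥ 1 and every m ∈ ℤ²: if |m| ≥ N then K⋆ⁿ_{>N}K(m) ≤ C'·(1+|m|²)^{nγ−1}, and if |m| < N then K⋆ⁿ_{>N}K(m) ≤ C'·(1+N²)^{nγ−1}. -/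
open scoped BigOperators

/-- The weight `1 + |m|²`. -/
noncomputable def wt (m : ℤ × ℤ) : ℝ := 1 + nsq m

lemma one_le_wt (m : ℤ × ℤ) : 1 ≤ wt m := by
  unfold wt nsq; nlinarith [sq_nonneg (m.1 : ℝ), sq_nonneg (m.2 : ℝ)]

lemma wt_pos (m : ℤ × ℤ) : 0 < wt m := lt_of_lt_of_le one_pos (one_le_wt m)

lemma card_le_of_wt (s : Finset (ℤ × ℤ)) (r : ℝ) (hr : 0 < r) (h : ∀ l ∈ s, wt l ≤ r) :
    (s.card : ℝ) ≤ 9 * r := by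
  rcases s.eq_empty_or_nonempty with rfl | ⟨l0, hl0⟩
  · simp; positivity
  have hr1 : 1 ≤ r := (one_le_wt l0).trans (h l0 hl0)
  set q : ℕ := ⌊Real.sqrt r⌋₊ with hq
  have hq1 : (q : ℝ) ≤ Real.sqrt r := Nat.floor_le (Real.sqrt_nonneg r)
  have hs1 : 1 ≤ Real.sqrt r := Real.one_le_sqrt.2 hr1
  have key : ∀ a : ℤ, (a : ℝ) ^ 2 ≤ r → a ∈ Finset.Icc (-(q : ℤ)) q := by
    intro a ha
    have h1 : |(a : ℝ)| ≤ Real.sqrt r := Real.abs_le_sqrt ha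
    have h2 : a.natAbs ≤ q := by
      apply Nat.le_floor
      rw [Nat.cast_natAbs]; push_cast; exact h1
    rw [Finset.mem_Icc]; omega
  have hsub : s ⊆ Finset.Icc (-(q : ℤ)) q ×ˢ Finset.Icc (-(q : ℤ)) q := by
    intro l hl
    have := h l hl
    unfold wt nsq at this
    rw [Finset.mem_product]
    exact ⟨key _ (by nlinarith [sq_nonneg (l.2 : ℝ)]), key _ (by nlinarith [sq_nonneg (l.1 : ℝ)])⟩
  have hc := Finset.card_le_card hsub
  rw [Finset.card_product, Int.card_Icc] at hc
  have e : ((q : ℤ) + 1 - (-(q : ℤ))).toNat = 2 * q + 1 := by omega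
  rw [e] at hc
  have hc' : (s.card : ℝ) ≤ (2 * q + 1) * (2 * q + 1) := by exact_mod_cast hc
  have hsq := Real.sq_sqrt hr.le
  have hq0 : (0 : ℝ) ≤ q := Nat.cast_nonneg q
  nlinarith

lemma shell_sum (s : Finset (ℤ × ℤ)) (M t p : ℝ) (hM : 0 < M) (ht : 0 < t) (hp : p ≤ 1)
    (htp : t ^ p < 1) (h : ∀ l ∈ s, ∃ k : ℕ, M * t ^ k ≤ wt l ∧ wt l ≤ 2 * (M * t ^ k)) :
    ∑ l ∈ s, wt l ^ (p - 1) ≤ 18 * (M ^ p / (1 - t ^ p)) := by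
  classical
  have h' : ∀ l : ℤ × ℤ, ∃ k : ℕ, l ∈ s → M * t ^ k ≤ wt l ∧ wt l ≤ 2 * (M * t ^ k) := by
    intro l
    by_cases hl : l ∈ s
    · obtain ⟨k, hk⟩ := h l hl
      exact ⟨k, fun _ => hk⟩
    · exact ⟨0, fun h => absurd h hl⟩
  choose f hf using h'
  have htp0 : 0 < t ^ p := Real.rpow_pos_of_pos ht p
  have hρ : ∀ k : ℕ, 0 < M * t ^ k := fun k => by positivity
  have hpow : ∀ k : ℕ, (M * t ^ k) ^ p = M ^ p * (t ^ p) ^ k := by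
    intro k
    rw [Real.mul_rpow hM.le (by positivity), ← Real.rpow_natCast t k, ← Real.rpow_mul ht.le,
      mul_comm (k : ℝ) p, Real.rpow_mul ht.le, Real.rpow_natCast]
  have hsum : HasSum (fun k : ℕ => M ^ p * (t ^ p) ^ k) (M ^ p * (1 - t ^ p)⁻¹) :=
    (hasSum_geometric_of_lt_one htp0.le htp).mul_left _
  rw [← Finset.sum_fiberwise_of_maps_to (s := s) (t := s.image f) (g := f)
    (fun l hl => Finset.mem_image_of_mem f hl)]
  calc _ ≤ ∑ k ∈ s.image f, 18 * (M ^ p * (t ^ p) ^ k) := by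
        apply Finset.sum_le_sum
        intro k _
        have hcard := card_le_of_wt (s.filter (fun l => f l = k)) (2 * (M * t ^ k))
          (by have := hρ k; positivity) (by
            intro l hl
            rw [Finset.mem_filter] at hl
            have := (hf l hl.1).2
            rwa [hl.2] at this)
        calc _ ≤ ∑ l ∈ s.filter (fun l => f l = k), (M * t ^ k) ^ (p - 1) := by
              apply Finset.sum_le_sum
              intro l hl
              rw [Finset.mem_filter] at hl
              have := (hf l hl.1).1
              rw [hl.2] at this
              exact Real.rpow_le_rpow_of_nonpos (hρ k) this (by linarith)
          _ = ((s.filter (fun l => f l = k)).card : ℝ) * (M * t ^ k) ^ (p - 1) := by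
              rw [Finset.sum_const, nsmul_eq_mul]
          _ ≤ 9 * (2 * (M * t ^ k)) * (M * t ^ k) ^ (p - 1) :=
              mul_le_mul_of_nonneg_right hcard (Real.rpow_nonneg (hρ k).le _)
          _ = 18 * (M ^ p * (t ^ p) ^ k) := by
              rw [← hpow, Real.rpow_sub_one (hρ k).ne']
              have := (hρ k).ne'
              field_simp
              norm_num
    _ = 18 * ∑ k ∈ s.image f, (M ^ p * (t ^ p) ^ k) := by rw [Finset.mul_sum]
    _ ≤ 18 * (M ^ p / (1 - t ^ p)) := by
        rw [div_eq_mul_inv]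
        apply mul_le_mul_of_nonneg_left _ (by norm_num)
        exact sum_le_hasSum _ (fun k _ => by positivity) hsum

lemma ball_sum (p : ℝ) (hp0 : 0 < p) (hp : p ≤ 1) :
    ∃ A : ℝ, 0 < A ∧ ∀ (M : ℝ) (s : Finset (ℤ × ℤ)), 0 < M → (∀ l ∈ s, wt l ≤ M) →
      ∑ l ∈ s, wt l ^ (p - 1) ≤ A * M ^ p := by
  have hq : ((1 : ℝ) / 2) ^ p < 1 := Real.rpow_lt_one (by norm_num) (by norm_num) hp0
  refine ⟨18 / (1 - (1 / 2) ^ p), div_pos (by norm_num) (by linarith), fun M s hM h => ?_⟩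
  have := shell_sum s (M / 2) (1 / 2) p (by positivity) (by norm_num) hp hq (by
    intro l hl
    have hw := wt_pos l
    obtain ⟨k, hk1, hk2⟩ := exists_nat_pow_near (x := M / wt l) (y := (2 : ℝ))
      ((one_le_div hw).2 (h l hl)) (by norm_num)
    refine ⟨k, ?_, ?_⟩
    · rw [div_lt_iff₀ hw, pow_succ] at hk2
      rw [one_div, inv_pow, ← div_eq_mul_inv, div_le_iff₀ (by positivity)]
      linarith
    · rw [le_div_iff₀ hw] at hk1
      rw [one_div, inv_pow, ← div_eq_mul_inv]
      have : 2 * (M / 2 / 2 ^ k) = M / 2 ^ k := by ring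
      rw [this, le_div_iff₀ (by positivity)]
      linarith)
  refine this.trans ?_
  have h2 : (M / 2) ^ p ≤ M ^ p := Real.rpow_le_rpow (by positivity) (by linarith) hp0.le
  have h3 : 0 < 1 - ((1 : ℝ) / 2) ^ p := by linarith
  calc _ = 18 / (1 - (1 / 2) ^ p) * (M / 2) ^ p := by ring
    _ ≤ _ := by gcongr

lemma tail_sum_s9 (p : ℝ) (hp0 : p < 0) :
    ∃ A : ℝ, 0 < A ∧ ∀ (M : ℝ) (s : Finset (ℤ × ℤ)), 0 < M → (∀ l ∈ s, M ≤ wt l) →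
      ∑ l ∈ s, wt l ^ (p - 1) ≤ A * M ^ p := by
  have hq : (2 : ℝ) ^ p < 1 := Real.rpow_lt_one_of_one_lt_of_neg (by norm_num) hp0
  refine ⟨18 / (1 - 2 ^ p), div_pos (by norm_num) (by linarith), fun M s hM h => ?_⟩
  have := shell_sum s M 2 p hM (by norm_num) (by linarith) hq (by
    intro l hl
    obtain ⟨k, hk1, hk2⟩ := exists_nat_pow_near (x := wt l / M) (y := (2 : ℝ))
      ((one_le_div hM).2 (h l hl)) (by norm_num)
    refine ⟨k, ?_, ?_⟩
    · rw [le_div_iff₀ hM] at hk1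
      linarith
    · rw [div_lt_iff₀ hM, pow_succ] at hk2
      linarith)
  refine this.trans (le_of_eq (by ring))

lemma wt_triangle (m l : ℤ × ℤ) : wt m ≤ 2 * wt (m - l) + 2 * wt l := by
  unfold wt nsq
  simp only [Prod.fst_sub, Prod.snd_sub, Int.cast_sub]
  nlinarith [sq_nonneg ((m.1 : ℝ) - 2 * l.1), sq_nonneg ((m.2 : ℝ) - 2 * l.2)]

lemma wt_triangle' (m l : ℤ × ℤ) : wt l ≤ 2 * wt (m - l) + 2 * wt m := by
  unfold wt nsq
  simp only [Prod.fst_sub, Prod.snd_sub, Int.cast_sub]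
  nlinarith [sq_nonneg (2 * (m.1 : ℝ) - l.1), sq_nonneg (2 * (m.2 : ℝ) - l.2)]

lemma quarter_rpow (x y p : ℝ) (hx : 0 < x) (hxy : x / 4 ≤ y) (hp0 : -1 ≤ p) (hp : p ≤ 0) :
    y ^ p ≤ 4 * x ^ p := by
  calc y ^ p ≤ (x / 4) ^ p := Real.rpow_le_rpow_of_nonpos (by positivity) hxy hp
    _ = x ^ p * 4 ^ (-p) := by
        rw [Real.div_rpow hx.le (by norm_num), Real.rpow_neg (by norm_num), div_eq_mul_inv]
    _ ≤ x ^ p * 4 ^ (1 : ℝ) := by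
        apply mul_le_mul_of_nonneg_left _ (by positivity)
        exact Real.rpow_le_rpow_of_exponent_le (by norm_num) (by linarith)
    _ = 4 * x ^ p := by rw [Real.rpow_one]; ring

lemma main_sum (γ β : ℝ) (hγ : 0 < γ) (hβ : 0 < β) (hs : γ + β < 1) :
    ∃ A : ℝ, 0 < A ∧ ∀ (R : ℝ) (m : ℤ × ℤ) (s : Finset (ℤ × ℤ)),
      ∑ l ∈ s, wt (m - l) ^ (γ - 1) * (max (wt l) R) ^ (β - 1)
        ≤ A * (max (wt m) R) ^ (γ + β - 1) := by
  classical
  obtain ⟨A1, hA1, h1⟩ := ball_sum γ hγ (by linarith)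
  obtain ⟨A2, hA2, h2⟩ := ball_sum β hβ (by linarith)
  obtain ⟨A3, hA3, h3⟩ := tail_sum_s9 (γ + β - 1) (by linarith)
  refine ⟨4 * A1 + 4 * A2 + 4 * A3, by positivity, fun R m s => ?_⟩
  set M := max (wt m) R with hMdef
  have hMm : wt m ≤ M := le_max_left _ _
  have hMR : R ≤ M := le_max_right _ _
  have hM : 0 < M := (wt_pos m).trans_le hMm
  have hterm : ∀ l ∈ s, wt (m - l) ^ (γ - 1) * (max (wt l) R) ^ (β - 1) ≤
      4 * M ^ (β - 1) * (if wt (m - l) ≤ M then wt (m - l) ^ (γ - 1) else 0)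
      + 4 * M ^ (γ - 1) * (if wt l ≤ M then wt l ^ (β - 1) else 0)
      + 4 * (if M ≤ wt l then wt l ^ (γ + β - 1 - 1) else 0) := by
    intro l _
    have hw := wt_pos l
    have hw' := wt_pos (m - l)
    have hx : wt l ≤ max (wt l) R := le_max_left _ _
    have hxR : R ≤ max (wt l) R := le_max_right _ _
    have hx0 : 0 < max (wt l) R := hw.trans_le hx
    have n1 : 0 ≤ 4 * M ^ (β - 1) * (if wt (m - l) ≤ M then wt (m - l) ^ (γ - 1) else 0) := by
      split_ifs <;> positivity
    have n2 : 0 ≤ 4 * M ^ (γ - 1) * (if wt l ≤ M then wt l ^ (β - 1) else 0) := by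
      split_ifs <;> positivity
    have n3 : 0 ≤ 4 * (if M ≤ wt l then wt l ^ (γ + β - 1 - 1) else 0) := by
      split_ifs <;> positivity
    have hmax : (max (wt l) R) ^ (β - 1) ≤ wt l ^ (β - 1) :=
      Real.rpow_le_rpow_of_nonpos hw hx (by linarith)
    have hMle : M ≤ 2 * wt (m - l) + 2 * max (wt l) R := by
      apply max_le
      · linarith [wt_triangle m l]
      · linarith
    have caseB : M / 4 ≤ wt (m - l) → wt l ≤ M →
        wt (m - l) ^ (γ - 1) * (max (wt l) R) ^ (β - 1) ≤
          4 * M ^ (γ - 1) * (if wt l ≤ M then wt l ^ (β - 1) else 0) := by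
      intro ha hb
      rw [if_pos hb]
      exact mul_le_mul (quarter_rpow _ _ _ hM ha (by linarith) (by linarith)) hmax
        (by positivity) (by positivity)
    by_cases hc : wt (m - l) ≤ M
    · by_cases hd : M / 4 ≤ max (wt l) R
      · have : wt (m - l) ^ (γ - 1) * (max (wt l) R) ^ (β - 1) ≤
            4 * M ^ (β - 1) * (if wt (m - l) ≤ M then wt (m - l) ^ (γ - 1) else 0) := by
          rw [if_pos hc, mul_comm]
          exact mul_le_mul_of_nonneg_right
            (quarter_rpow _ _ _ hM hd (by linarith) (by linarith)) (by positivity)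
        linarith
      · push Not at hd
        have := caseB (by linarith) (by linarith)
        linarith
    · push Not at hc
      by_cases he : wt l ≤ M
      · have := caseB (by linarith) he
        linarith
      · push Not at he
        have hq : wt l / 4 ≤ wt (m - l) := by linarith [wt_triangle' m l]
        have : wt (m - l) ^ (γ - 1) * (max (wt l) R) ^ (β - 1) ≤
            4 * (if M ≤ wt l then wt l ^ (γ + β - 1 - 1) else 0) := by
          rw [if_pos he.le, show γ + β - 1 - 1 = (γ - 1) + (β - 1) by ring, Real.rpow_add hw,
            ← mul_assoc]
          exact mul_le_mul (quarter_rpow _ _ _ hw hq (by linarith) (by linarith)) hmax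
            (by positivity) (by positivity)
        linarith
  refine (Finset.sum_le_sum hterm).trans ?_
  rw [Finset.sum_add_distrib, Finset.sum_add_distrib, ← Finset.mul_sum, ← Finset.mul_sum,
    ← Finset.mul_sum, ← Finset.sum_filter, ← Finset.sum_filter, ← Finset.sum_filter]
  have b1 : ∑ l ∈ s.filter (fun l => wt (m - l) ≤ M), wt (m - l) ^ (γ - 1) ≤ A1 * M ^ γ := by
    have := h1 M ((s.filter (fun l => wt (m - l) ≤ M)).image (fun l => m - l)) hM (by
      intro l hl
      rw [Finset.mem_image] at hl
      obtain ⟨a, ha, rfl⟩ := hl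
      exact (Finset.mem_filter.1 ha).2)
    rwa [Finset.sum_image (fun a _ b _ hab => sub_right_injective hab)] at this
  have b2 := h2 M (s.filter (fun l => wt l ≤ M)) hM (fun l hl => (Finset.mem_filter.1 hl).2)
  have b3 := h3 M (s.filter (fun l => M ≤ wt l)) hM (fun l hl => (Finset.mem_filter.1 hl).2)
  have e1 : M ^ (β - 1) * M ^ γ = M ^ (γ + β - 1) := by
    rw [← Real.rpow_add hM]; congr 1; ring
  have e2 : M ^ (γ - 1) * M ^ β = M ^ (γ + β - 1) := by
    rw [← Real.rpow_add hM]; congr 1; ring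
  calc _ ≤ 4 * M ^ (β - 1) * (A1 * M ^ γ) + 4 * M ^ (γ - 1) * (A2 * M ^ β)
        + 4 * (A3 * M ^ (γ + β - 1)) := by gcongr
    _ = 4 * A1 * (M ^ (β - 1) * M ^ γ) + 4 * A2 * (M ^ (γ - 1) * M ^ β)
        + 4 * A3 * M ^ (γ + β - 1) := by ring
    _ = _ := by rw [e1, e2]; ring

lemma iter_bound (γ : ℝ) (hγ : 0 < γ) (C : ℝ) (hC : 0 < C) (k : ℕ) :
    ((k : ℝ) + 1) * γ < 1 →
    ∃ D : ℝ, 0 < D ∧ ∀ K : ℤ × ℤ → ℝ, (∀ m, 0 < K m) → (∀ m, K m ≤ C * wt m ^ (γ - 1)) →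
      ∀ N : ℕ, ∀ m : ℤ × ℤ,
        0 ≤ iterConvLE N K (k + 1) m ∧ iterConvLE N K (k + 1) m ≤ iterConv K (k + 1) m ∧
        iterConv K (k + 1) m ≤ D * wt m ^ (((k : ℝ) + 1) * γ - 1) ∧
        iterConvGT N K (k + 1) m ≤
          D * (max (wt m) (1 + (N : ℝ) ^ 2)) ^ (((k : ℝ) + 1) * γ - 1) := by
  induction k with
  | zero =>
    intro _
    refine ⟨C, hC, fun K hK hKC N m => ?_⟩
    have := hKC m
    have h0 : (0 : ℝ) ≤ C * (max (wt m) (1 + (N : ℝ) ^ 2)) ^ (γ - 1) := by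
      have := wt_pos m
      positivity
    simp only [Nat.cast_zero, zero_add, one_mul, iterConvGT, iterConv, iterConvLE, sub_self]
    exact ⟨(hK m).le, le_rfl, this, h0⟩
  | succ k ih =>
    intro hk
    push_cast at hk
    obtain ⟨D, hD, ih⟩ := ih (by nlinarith)
    set β : ℝ := ((k : ℝ) + 1) * γ with hβ
    obtain ⟨A, hA, hm⟩ := main_sum γ β hγ (by positivity) (by rw [hβ]; linarith)
    refine ⟨C * D * A, by positivity, fun K hK hKC N m => ?_⟩
    have hexp : ((((k + 1 : ℕ) : ℝ)) + 1) * γ - 1 = γ + β - 1 := by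
      rw [hβ]; push_cast; ring
    rw [hexp]
    set R : ℝ := 1 + (N : ℝ) ^ 2 with hR
    have ih := ih K hK hKC N
    set I := iterConv K (k + 1) with hI
    set L := iterConvLE N K (k + 1) with hL
    have eI : iterConv K (k + 1 + 1) m = ∑' l, K (m - l) * I l := rfl
    have eL : iterConvLE N K (k + 1 + 1) m = ∑' l, Set.indicator
      {l : ℤ × ℤ | norm2 l ≤ (N : ℝ)} (fun l => K (m - l) * L l) l := rfl
    have hI0 : ∀ l, 0 ≤ I l := fun l => (ih l).1.trans (ih l).2.1
    -- general bound
    have gen : ∀ (Q : ℝ) (f : ℤ × ℤ → ℝ), (∀ l, f l ≤ K (m - l) * (D * (max (wt l) Q) ^ (β - 1))) →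
        ∀ s : Finset (ℤ × ℤ), ∑ l ∈ s, f l ≤ C * D * A * (max (wt m) Q) ^ (γ + β - 1) := by
      intro Q f hf s
      calc ∑ l ∈ s, f l ≤ ∑ l ∈ s, C * D * (wt (m - l) ^ (γ - 1) * (max (wt l) Q) ^ (β - 1)) := by
            apply Finset.sum_le_sum
            intro l _
            have hx0 : 0 < max (wt l) Q := (wt_pos l).trans_le (le_max_left _ _)
            calc f l ≤ K (m - l) * (D * (max (wt l) Q) ^ (β - 1)) := hf l
              _ ≤ (C * wt (m - l) ^ (γ - 1)) * (D * (max (wt l) Q) ^ (β - 1)) :=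
                  mul_le_mul_of_nonneg_right (hKC _) (by positivity)
              _ = _ := by ring
        _ = C * D * ∑ l ∈ s, (wt (m - l) ^ (γ - 1) * (max (wt l) Q) ^ (β - 1)) := by
            rw [Finset.mul_sum]
        _ ≤ C * D * (A * (max (wt m) Q) ^ (γ + β - 1)) :=
            mul_le_mul_of_nonneg_left (hm Q m s) (by positivity)
        _ = _ := by ring
    have b1 := gen 1 (fun l => K (m - l) * I l) (by
      intro l
      rw [max_eq_left (one_le_wt l)]
      exact mul_le_mul_of_nonneg_left (ih l).2.2.1 (hK _).le)
    rw [max_eq_left (one_le_wt m)] at b1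
    have nn1 : ∀ l, 0 ≤ K (m - l) * I l := fun l => mul_nonneg (hK _).le (hI0 l)
    have S1 : Summable (fun l => K (m - l) * I l) := summable_of_sum_le nn1 b1
    have nn2 : ∀ l, 0 ≤ Set.indicator
        {l : ℤ × ℤ | norm2 l ≤ (N : ℝ)} (fun l => K (m - l) * L l) l := fun l =>
      Set.indicator_nonneg (fun l _ => mul_nonneg (hK _).le (ih l).1) l
    have le2 : ∀ l, Set.indicator
        {l : ℤ × ℤ | norm2 l ≤ (N : ℝ)} (fun l => K (m - l) * L l) l ≤ K (m - l) * I l := by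
      intro l
      by_cases hl : l ∈ {l : ℤ × ℤ | norm2 l ≤ (N : ℝ)}
      · rw [Set.indicator_of_mem hl]
        exact mul_le_mul_of_nonneg_left (ih l).2.1 (hK _).le
      · rw [Set.indicator_of_notMem hl]
        exact nn1 l
    have S2 := Summable.of_nonneg_of_le nn2 le2 S1
    refine ⟨?_, ?_, ?_, ?_⟩
    · rw [eL]; exact tsum_nonneg nn2
    · rw [eL, eI]; exact S2.tsum_le_tsum le2 S1
    · rw [eI]; exact Real.tsum_le_of_sum_le nn1 b1
    · unfold iterConvGT
      rw [eL, eI, ← S1.tsum_sub S2]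
      refine Real.tsum_le_of_sum_le (fun l => sub_nonneg.2 (le2 l)) (gen R _ ?_)
      intro l
      by_cases hl : l ∈ {l : ℤ × ℤ | norm2 l ≤ (N : ℝ)}
      · rw [Set.indicator_of_mem hl, ← mul_sub]
        exact mul_le_mul_of_nonneg_left (ih l).2.2.2 (hK _).le
      · rw [Set.indicator_of_notMem hl, sub_zero]
        have hl' : (N : ℝ) < norm2 l := not_le.1 hl
        have : R ≤ wt l := by
          unfold norm2 at hl'
          rw [Real.lt_sqrt (Nat.cast_nonneg N)] at hl'
          unfold wt; rw [hR]; linarith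
        rw [max_eq_left this]
        exact mul_le_mul_of_nonneg_left (ih l).2.2.1 (hK _).le

theorem stmt_9 (n : ℕ) (hn : 2 ≤ n) (γ : ℝ) (hγ0 : 0 < γ) (hγn : γ < 1 / (n : ℝ))
    (C : ℝ) (hC : 0 < C) :
    ∃ C' : ℝ, 0 < C' ∧
      ∀ K : ℤ × ℤ → ℝ,
        (∀ m, 0 < K m) →
        (∀ m, K m ≤ C * (1 + nsq m) ^ (γ - 1)) →
        ∀ N : ℕ, 1 ≤ N → ∀ m : ℤ × ℤ,
          ((N : ℝ) ≤ norm2 m →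
            iterConvGT N K n m ≤ C' * (1 + nsq m) ^ ((n : ℝ) * γ - 1)) ∧
          (norm2 m < (N : ℝ) →
            iterConvGT N K n m ≤ C' * (1 + (N : ℝ) ^ 2) ^ ((n : ℝ) * γ - 1)) := by
  obtain ⟨k, rfl⟩ : ∃ k, n = k + 1 := ⟨n - 1, by omega⟩
  have hpos : (0 : ℝ) < ((k + 1 : ℕ) : ℝ) := by positivity
  rw [lt_div_iff₀ hpos] at hγn
  push_cast at hγn ⊢
  obtain ⟨D, hD, h⟩ := iter_bound γ hγ0 C hC k (by linarith)
  refine ⟨D, hD, fun K hK hKC N _ m => ?_⟩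
  have hh := (h K hK hKC N m).2.2.2
  constructor
  · intro hN
    unfold norm2 at hN
    rw [Real.le_sqrt' (by positivity)] at hN
    rwa [max_eq_left (by unfold wt; linarith)] at hh
  · intro hN
    unfold norm2 at hN
    rw [Real.sqrt_lt' (by positivity)] at hN
    rwa [max_eq_right (by unfold wt; linarith)] at hh
end
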